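/- Let (X_t)_{t≥0} be a regular, non-explosive birth–death process on {0,1,…,n} and suppose there exists K > 0 such that min_{x ∈ {1,…,n}} (λ_{x−1} − λ_x + ν_x − ν_{x−1}) ≥ K. Then for every Lipschitz f on {0,…,n}, every x, t > 0 and y > 0: P_x(f(X_t) − E_x[f(X_t)] ≥ y) ≤ exp( −(y/(2‖f‖_Lip)) · log(1 + 2Ky/((1−e^{−2Kt}) ‖λ+ν‖_∞ ‖f‖_Lip)) ); moreover, under the stationary distribution π, π(f − π(f) ≥ y) ≤ exp( −(y/(2‖f‖_Lip)) · log(1 + 2Ky/(‖λ+ν‖_∞ ‖f‖_Lip)) ). -/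

import Mathlib

open Set

/-- The Lipschitz seminorm of `f : {0,…,n} → ℝ` with respect to the metric
`d(x,y) = |x - y|`. -/
noncomputable def lipNormFin {n : ℕ} (f : Fin (n + 1) → ℝ) : ℝ :=
  sSup {r | ∃ x y : Fin (n + 1), x ≠ y ∧
    r = |f x - f y| / |((x : ℕ) : ℝ) - ((y : ℕ) : ℝ)|}

/-- A regular, non-explosive birth–death process on the finite state space
`E = {0, 1, …, n}`, with birth rates `lam`, death rates `nu` (both reflecting
states: `nu 0 = 0` and `lam n = 0`, the other rates being positive), transition
probabilities `P t x y = ℙ_x(X_t = y)` and stationary distribution `pi`.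
The generator is `L f (x) = lam x (f(x+1) - f(x)) + nu x (f(x-1) - f(x))`,
encoded through the right derivative at `t = 0` of the transition
probabilities. -/
structure BDChainFin (n : ℕ) where
  lam : Fin (n + 1) → ℝ
  nu : Fin (n + 1) → ℝ
  P : ℝ → Fin (n + 1) → Fin (n + 1) → ℝ
  pi : Fin (n + 1) → ℝ
  lam_pos : ∀ x : Fin (n + 1), (x : ℕ) < n → 0 < lam x
  lam_last : lam (Fin.last n) = 0
  nu_pos : ∀ x : Fin (n + 1), 0 < (x : ℕ) → 0 < nu x
  nu_zero : nu 0 = 0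
  P_nonneg : ∀ t x y, 0 ≤ t → 0 ≤ P t x y
  P_sum : ∀ t x, 0 ≤ t → ∑ y, P t x y = 1
  P_zero : ∀ x y, P 0 x y = if x = y then 1 else 0
  P_semigroup : ∀ s t, 0 ≤ s → 0 ≤ t → ∀ x z, P (s + t) x z = ∑ y, P s x y * P t y z
  P_gen : ∀ x y : Fin (n + 1), x ≠ y →
    HasDerivWithinAt (fun t => P t x y)
      (if (y : ℕ) = (x : ℕ) + 1 then lam x
        else if (y : ℕ) + 1 = (x : ℕ) then nu x else 0)
      (Set.Ici (0 : ℝ)) 0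
  pi_nonneg : ∀ x, 0 ≤ pi x
  pi_sum : ∑ x, pi x = 1
  pi_stationary : ∀ t, 0 ≤ t → ∀ y, ∑ x, pi x * P t x y = pi y

/-! ### Real-variable estimates -/

/-- The function `u ↦ exp u - u - 1` governing Poisson-type deviations. -/
noncomputable def expRemainder (u : ℝ) : ℝ := Real.exp u - u - 1

lemma expRemainder_nonneg (u : ℝ) : 0 ≤ expRemainder u := by
  unfold expRemainder
  linarith [Real.add_one_le_exp u]

lemma expRemainder_le_of_abs_le {v w : ℝ} (h : |v| ≤ w) :
    expRemainder v ≤ expRemainder w := by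
  have mono : ∀ a b : ℝ, 0 ≤ a → a ≤ b → expRemainder a ≤ expRemainder b := by
    intro a b ha hab
    have h1 : Real.exp b = Real.exp a * Real.exp (b - a) := by
      rw [← Real.exp_add]; ring_nf
    have h2 := Real.add_one_le_exp (b - a)
    have h3 := Real.one_le_exp ha
    unfold expRemainder
    rw [h1]
    nlinarith
  refine le_trans ?_ (mono _ _ (abs_nonneg v) h)
  rcases le_total 0 v with hv | hv
  · rw [abs_of_nonneg hv]
  · rw [abs_of_nonpos hv]
    have h1 := Real.self_le_sinh_iff.2 (neg_nonneg.2 hv)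
    rw [Real.sinh_eq, neg_neg] at h1
    unfold expRemainder
    linarith

lemma expRemainder_mul_le {a u : ℝ} (ha0 : 0 ≤ a) (ha1 : a ≤ 1) (hu : 0 ≤ u) :
    expRemainder (a * u) ≤ a ^ 2 * expRemainder u := by
  have hder : ∀ v : ℝ, HasDerivAt (fun v => a ^ 2 * expRemainder v - expRemainder (a * v))
      (a ^ 2 * (Real.exp v - 1) - (Real.exp (a * v) * a - a)) v := by
    intro v
    unfold expRemainder
    have h1 : HasDerivAt (fun v : ℝ => a * v) a v := by
      simpa using (hasDerivAt_id v).const_mul a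
    exact ((((Real.hasDerivAt_exp v).sub (hasDerivAt_id v)).sub_const 1).const_mul (a ^ 2)).sub
      ((h1.exp.sub h1).sub_const 1)
  have hmono : MonotoneOn (fun v => a ^ 2 * expRemainder v - expRemainder (a * v)) (Ici 0) := by
    refine monotoneOn_of_deriv_nonneg (convex_Ici 0)
      (fun v _ => (hder v).continuousAt.continuousWithinAt)
      (fun v _ => (hder v).differentiableAt.differentiableWithinAt) (fun v _ => ?_)
    rw [(hder v).deriv]
    have hc := convexOn_exp.2 (mem_univ (0 : ℝ)) (mem_univ v) (sub_nonneg.2 ha1) ha0 (by ring)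
    simp only [smul_eq_mul, mul_zero, zero_add, Real.exp_zero, mul_one] at hc
    nlinarith
  have := hmono (mem_Ici.2 le_rfl) (mem_Ici.2 hu) hu
  simp only [expRemainder, mul_zero, Real.exp_zero] at this ⊢
  linarith

/-- Chernoff's bound for a finitely supported law whose Laplace transform is of Poisson type. -/
lemma sum_deviation_le_of_laplace_le {ι : Type*} [Fintype ι] (p f : ι → ℝ)
    (hp : ∀ i, 0 ≤ p i) {m M C y : ℝ} (hM : 0 < M) (hC : 0 < C) (hy : 0 < y)
    (hlap : ∀ θ, 0 ≤ θ →
      ∑ i, p i * Real.exp (θ * f i) ≤ Real.exp (θ * m + M * expRemainder (θ * C))) :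
    (∑ i, if y ≤ f i - m then p i else 0) ≤
      Real.exp (-(y / (2 * C)) * Real.log (1 + y / (M * C))) := by
  set u := y / (M * C) with hu
  have hu0 : 0 < u := by positivity
  set l := Real.log (1 + u) with hl
  have hl0 : 0 ≤ l := Real.log_nonneg (by linarith)
  have hyu : y = M * C * u := by rw [hu]; field_simp
  have hθ : 0 ≤ l / C := by positivity
  calc (∑ i, if y ≤ f i - m then p i else 0)
      ≤ ∑ i, Real.exp (-(l / C * (m + y))) * (p i * Real.exp (l / C * f i)) := by
        refine Finset.sum_le_sum fun i _ => ?_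
        rw [mul_left_comm, ← Real.exp_add]
        split_ifs with h
        · refine le_mul_of_one_le_right (hp i) (Real.one_le_exp ?_)
          nlinarith [mul_nonneg hθ (sub_nonneg.2 h)]
        · exact mul_nonneg (hp i) (Real.exp_pos _).le
    _ ≤ Real.exp (-(l / C * (m + y))) *
          Real.exp (l / C * m + M * expRemainder (l / C * C)) := by
        rw [← Finset.mul_sum]
        exact mul_le_mul_of_nonneg_left (hlap _ hθ) (Real.exp_pos _).le
    _ ≤ Real.exp (-(y / (2 * C)) * l) := by
        rw [← Real.exp_add]
        refine Real.exp_le_exp.2 ?_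
        rw [div_mul_cancel₀ _ hC.ne', expRemainder, hl, Real.exp_log (by linarith), ← hl, hyu]
        have h1 := Real.le_log_one_add_of_nonneg hu0.le
        rw [← hl, div_le_iff₀ (by linarith)] at h1
        have h2 : -(l / C * (m + M * C * u)) + (l / C * m + M * (1 + u - l - 1)) -
            -(M * C * u / (2 * C)) * l = - (M / 2) * (l * (u + 2) - 2 * u) := by
          field_simp
          ring
        nlinarith

/-! ### The generator and its semigroup -/

namespace BDChainFin

lemma val_add_one_lt {n : ℕ} (x : Fin (n + 1)) (h : (x : ℕ) < n) : (x : ℕ) + 1 < n + 1 :=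
  Nat.succ_lt_succ h

/-- The upper neighbour, with `n` sent to itself. -/
def up {n : ℕ} (x : Fin (n + 1)) : Fin (n + 1) :=
  if h : (x : ℕ) < n then ⟨x + 1, val_add_one_lt x h⟩ else x

/-- The lower neighbour, with `0` sent to itself. -/
def down {n : ℕ} (x : Fin (n + 1)) : Fin (n + 1) := ⟨(x : ℕ) - 1, by omega⟩

variable {n : ℕ} (B : BDChainFin n)

lemma lam_nonneg (x : Fin (n + 1)) : 0 ≤ B.lam x := by
  rcases Nat.lt_or_ge (x : ℕ) n with h | h
  · exact (B.lam_pos x h).le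
  · have : x = Fin.last n := Fin.ext (by simp only [Fin.val_last]; omega)
    rw [this, B.lam_last]

lemma nu_nonneg (x : Fin (n + 1)) : 0 ≤ B.nu x := by
  rcases Nat.eq_zero_or_pos (x : ℕ) with h | h
  · have : x = 0 := Fin.ext h
    rw [this, B.nu_zero]
  · exact (B.nu_pos x h).le

/-- The generator `L g (x) = λ_x (g (x+1) - g x) + ν_x (g (x-1) - g x)`. -/
noncomputable def gen : (Fin (n + 1) → ℝ) →L[ℝ] (Fin (n + 1) → ℝ) :=
  LinearMap.toContinuousLinearMap
    { toFun := fun g x => B.lam x * (g (up x) - g x) + B.nu x * (g (down x) - g x)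
      map_add' := fun g h => by ext x; simp only [Pi.add_apply]; ring
      map_smul' := fun c g => by
        ext x; simp only [Pi.smul_apply, smul_eq_mul, RingHom.id_apply]; ring }

lemma gen_apply (g : Fin (n + 1) → ℝ) (x : Fin (n + 1)) :
    B.gen g x = B.lam x * (g (up x) - g x) + B.nu x * (g (down x) - g x) := rfl

/-- The action `P_t g (x) = E_x[g(X_t)]` of the transition probabilities. -/
noncomputable def act (t : ℝ) (g : Fin (n + 1) → ℝ) : Fin (n + 1) → ℝ :=
  fun x => ∑ y, B.P t x y * g y

lemma act_zero (g : Fin (n + 1) → ℝ) : B.act 0 g = g := by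
  ext x
  simp [act, B.P_zero]

lemma act_add {s t : ℝ} (hs : 0 ≤ s) (ht : 0 ≤ t) (g : Fin (n + 1) → ℝ) :
    B.act (s + t) g = B.act s (B.act t g) := by
  ext x
  simp only [act, B.P_semigroup s t hs ht, Finset.sum_mul, Finset.mul_sum]
  rw [Finset.sum_comm]
  simp only [mul_assoc]

lemma act_sub (t : ℝ) (g h : Fin (n + 1) → ℝ) :
    B.act t (g - h) = B.act t g - B.act t h := by
  ext x
  simp only [act, Pi.sub_apply, mul_sub, Finset.sum_sub_distrib]

lemma act_mono {t : ℝ} (ht : 0 ≤ t) {g h : Fin (n + 1) → ℝ} (hgh : ∀ x, g x ≤ h x)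
    (x : Fin (n + 1)) : B.act t g x ≤ B.act t h x :=
  Finset.sum_le_sum fun y _ => mul_le_mul_of_nonneg_left (hgh y) (B.P_nonneg t x y ht)

lemma norm_act_le {t : ℝ} (ht : 0 ≤ t) (g : Fin (n + 1) → ℝ) : ‖B.act t g‖ ≤ ‖g‖ := by
  refine (pi_norm_le_iff_of_nonneg (norm_nonneg _)).2 fun x => ?_
  calc ‖B.act t g x‖ ≤ ∑ y, ‖B.P t x y * g y‖ := norm_sum_le _ _
    _ ≤ ∑ y, B.P t x y * ‖g‖ := by
        refine Finset.sum_le_sum fun y _ => ?_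
        rw [norm_mul, Real.norm_of_nonneg (B.P_nonneg t x y ht)]
        exact mul_le_mul_of_nonneg_left (norm_le_pi_norm g y) (B.P_nonneg t x y ht)
    _ = ‖g‖ := by rw [← Finset.sum_mul, B.P_sum t x ht, one_mul]

lemma sum_rates_mul (g : Fin (n + 1) → ℝ) (x : Fin (n + 1)) :
    ∑ y : Fin (n + 1), (if (y : ℕ) = (x : ℕ) + 1 then B.lam x
        else if (y : ℕ) + 1 = (x : ℕ) then B.nu x else 0) * (g y - g x) = B.gen g x := by
  have hsplit : ∀ y : Fin (n + 1), (if (y : ℕ) = (x : ℕ) + 1 then B.lam x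
        else if (y : ℕ) + 1 = (x : ℕ) then B.nu x else 0) * (g y - g x) =
      (if (y : ℕ) = (x : ℕ) + 1 then B.lam x * (g y - g x) else 0) +
      (if (y : ℕ) + 1 = (x : ℕ) then B.nu x * (g y - g x) else 0) := by
    intro y
    split_ifs <;> first | omega | ring
  rw [Finset.sum_congr rfl fun y _ => hsplit y, Finset.sum_add_distrib, gen_apply]
  congr 1
  · rw [Finset.sum_eq_single (up x)]
    · split_ifs with h
      · rfl
      · have : x = Fin.last n := Fin.ext (by
          by_contra hx
          rw [Fin.val_last] at hx
          have hlt : (x : ℕ) < n := by omega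
          exact h (by simp [up, hlt]))
        rw [this, B.lam_last, zero_mul]
    · intro y _ hy
      refine if_neg fun h => hy ?_
      have : (x : ℕ) < n := by omega
      exact Fin.ext (by simp [up, this, h])
    · simp
  · rw [Finset.sum_eq_single (down x)]
    · split_ifs with h
      · rfl
      · have : x = 0 := Fin.ext (by simp only [down] at h; rw [Fin.val_zero]; omega)
        rw [this, B.nu_zero, zero_mul]
    · intro y _ hy
      refine if_neg fun h => hy ?_
      exact Fin.ext (by simp only [down]; omega)
    · simp

lemma hasDerivWithinAt_act_zero (g : Fin (n + 1) → ℝ) :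
    HasDerivWithinAt (fun t => B.act t g) (B.gen g) (Ici 0) 0 := by
  rw [hasDerivWithinAt_pi]
  intro x
  have h1 : HasDerivWithinAt (fun t => ∑ y, B.P t x y * (g y - g x)) (B.gen g x) (Ici 0) 0 := by
    rw [← B.sum_rates_mul]
    refine HasDerivWithinAt.fun_sum fun y _ => ?_
    rcases eq_or_ne x y with rfl | hxy
    · simpa using hasDerivWithinAt_const (0 : ℝ) (Ici (0 : ℝ)) (0 : ℝ)
    · exact (B.P_gen x y hxy).mul_const _
  have h2 : ∀ t ∈ Ici (0 : ℝ), B.act t g x = (∑ y, B.P t x y * (g y - g x)) + g x := by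
    intro t ht
    simp only [act, mul_sub, Finset.sum_sub_distrib, ← Finset.sum_mul, B.P_sum t x ht]
    ring
  exact (h1.add_const (g x)).congr h2 (h2 0 (mem_Ici.2 le_rfl))

lemma hasDerivWithinAt_act {t : ℝ} (ht : 0 ≤ t) (g : Fin (n + 1) → ℝ) :
    HasDerivWithinAt (fun s => B.act s g) (B.gen (B.act t g)) (Ici t) t := by
  have h0 := B.hasDerivWithinAt_act_zero (B.act t g)
  have h1 : HasDerivWithinAt (fun s : ℝ => s - t) 1 (Ici t) t :=
    ((hasDerivAt_id t).sub_const t).hasDerivWithinAt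
  have h2 := HasDerivWithinAt.scomp_of_eq t h0 h1
    (fun s hs => mem_Ici.2 (sub_nonneg.2 (mem_Ici.1 hs))) (sub_self t).symm
  rw [one_smul] at h2
  refine h2.congr (fun s hs => ?_) ?_
  · rw [Function.comp_apply, ← B.act_add (sub_nonneg.2 (mem_Ici.1 hs)) ht, sub_add_cancel]
  · rw [Function.comp_apply, sub_self, B.act_zero]

lemma norm_act_sub_act_le {s t : ℝ} (hs : 0 ≤ s) (ht : 0 ≤ t) (g : Fin (n + 1) → ℝ) :
    ‖B.act s g - B.act t g‖ ≤ ‖B.act |s - t| g - g‖ := by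
  wlog hst : s ≤ t generalizing s t
  · rw [norm_sub_rev, abs_sub_comm]
    exact this ht hs (le_of_not_ge hst)
  have h : B.act t g = B.act s (B.act |s - t| g) := by
    rw [← B.act_add hs (abs_nonneg _), abs_of_nonpos (by linarith)]
    ring_nf
  rw [h, norm_sub_rev, ← B.act_sub]
  exact B.norm_act_le hs _

lemma continuousOn_act (g : Fin (n + 1) → ℝ) : ContinuousOn (fun t => B.act t g) (Ici 0) := by
  intro t ht
  rw [ContinuousWithinAt, tendsto_iff_norm_sub_tendsto_zero]
  have h0 : ContinuousWithinAt (fun s => ‖B.act s g - g‖) (Ici 0) 0 :=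
    ((B.hasDerivWithinAt_act_zero g).continuousWithinAt.sub continuousWithinAt_const).norm
  have h1 : Filter.Tendsto (fun s : ℝ => |s - t|) (nhdsWithin t (Ici 0))
      (nhdsWithin 0 (Ici 0)) := by
    refine tendsto_nhdsWithin_iff.2 ⟨?_, Filter.Eventually.of_forall fun s => mem_Ici.2 (abs_nonneg _)⟩
    have : Continuous fun s : ℝ => |s - t| := by fun_prop
    simpa using (this.tendsto t).mono_left nhdsWithin_le_nhds
  have h2 := h0.tendsto.comp h1
  simp only [B.act_zero, sub_self, norm_zero] at h2
  refine squeeze_zero' (Filter.Eventually.of_forall fun s => norm_nonneg _) ?_ h2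
  filter_upwards [self_mem_nhdsWithin] with s hs
  exact B.norm_act_sub_act_le hs ht g

/-- The group `exp (t L)` generated by `L`, defined for all real times. -/
noncomputable def expGen (t : ℝ) : (Fin (n + 1) → ℝ) →L[ℝ] (Fin (n + 1) → ℝ) :=
  NormedSpace.exp (t • B.gen)

lemma hasDerivAt_expGen (t : ℝ) : HasDerivAt B.expGen (B.expGen t * B.gen) t :=
  hasDerivAt_exp_smul_const B.gen t

lemma hasDerivAt_expGen_apply (g : Fin (n + 1) → ℝ) (t : ℝ) :
    HasDerivAt (fun s => B.expGen s g) (B.gen (B.expGen t g)) t := by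
  have h : HasDerivAt B.expGen (B.gen * B.expGen t) t := hasDerivAt_exp_smul_const' B.gen t
  simpa using h.clm_apply (hasDerivAt_const t g)

lemma expGen_zero (g : Fin (n + 1) → ℝ) : B.expGen 0 g = g := by
  simp [expGen]

lemma act_eq_expGen {t : ℝ} (ht : 0 ≤ t) (g : Fin (n + 1) → ℝ) : B.act t g = B.expGen t g := by
  rw [← sub_eq_zero]
  refine eq_zero_of_abs_deriv_le_mul_abs_self_of_eq_zero_right
    (f := fun s => B.act s g - B.expGen s g)
    (f' := fun s => B.gen (B.act s g) - B.gen (B.expGen s g)) (K := ‖B.gen‖) (a := 0) (b := t)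
    ?_ (fun s hs => ?_) ?_ (fun s _ => ?_) t ⟨ht, le_rfl⟩
  · refine ((B.continuousOn_act g).mono Icc_subset_Ici_self).sub fun s _ => ?_
    exact (B.hasDerivAt_expGen_apply g s).continuousAt.continuousWithinAt
  · exact (B.hasDerivWithinAt_act hs.1 g).sub (B.hasDerivAt_expGen_apply g s).hasDerivWithinAt
  · simp only [B.act_zero, B.expGen_zero, sub_self]
  · rw [← map_sub]
    exact B.gen.le_opNorm _

/-! ### Contraction of the gradient -/

lemma abs_down_sub_le {g : Fin (n + 1) → ℝ} {m : ℝ} (hg : ∀ x, |g (up x) - g x| ≤ m)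
    (x : Fin (n + 1)) : |g (down x) - g x| ≤ m := by
  rcases Nat.eq_zero_or_pos (x : ℕ) with h | h
  · have : down x = x := Fin.ext (by simp only [down]; omega)
    rw [this, sub_self, abs_zero]
    exact (abs_nonneg _).trans (hg x)
  · have : up (down x) = x := by
      have hlt : (x : ℕ) - 1 < n := by omega
      exact Fin.ext (by simp [up, down, hlt]; omega)
    have h1 := hg (down x)
    rwa [this, abs_sub_comm] at h1

lemma abs_sub_le_of_gradient_le {g : Fin (n + 1) → ℝ} {m : ℝ}
    (hg : ∀ x, |g (up x) - g x| ≤ m) (x z : Fin (n + 1)) : |g x - g z| ≤ 2 * n * m := by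
  have hm : 0 ≤ m := (abs_nonneg _).trans (hg 0)
  have key : ∀ k : ℕ, ∀ hk : k < n + 1, |g ⟨k, hk⟩ - g 0| ≤ k * m := by
    intro k
    induction k with
    | zero => intro hk; simp
    | succ k ih =>
      intro hk
      have hlt : k < n := by omega
      have h1 := ih (by omega)
      have h2 := hg ⟨k, by omega⟩
      simp only [up, hlt, dif_pos] at h2
      have h3 := abs_sub_le (g ⟨k + 1, hk⟩) (g ⟨k, by omega⟩) (g 0)
      push_cast
      linarith
  have bound : ∀ w : Fin (n + 1), |g w - g 0| ≤ n * m := fun w =>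
    (key w w.2).trans (mul_le_mul_of_nonneg_right (by exact_mod_cast Nat.lt_succ_iff.1 w.2) hm)
  have h1 := abs_sub_le (g x) (g 0) (g z)
  have h2 := bound z
  rw [abs_sub_comm] at h2
  linarith [bound x]

variable {K : ℝ}

lemma abs_mul_gradient_add_gradient_gen_le
    (hrates : ∀ x : Fin (n + 1), (x : ℕ) < n →
      K ≤ B.lam x - B.lam (up x) + B.nu (up x) - B.nu x)
    {c : ℝ} (hcK : K ≤ c) (hc : ∀ x, B.lam x + B.nu (up x) ≤ c)
    {g : Fin (n + 1) → ℝ} {m : ℝ} (hg : ∀ x, |g (up x) - g x| ≤ m) (x : Fin (n + 1)) :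
    |c * (g (up x) - g x) + (B.gen g (up x) - B.gen g x)| ≤ (c - K) * m := by
  have hm : 0 ≤ m := (abs_nonneg _).trans (hg 0)
  rcases Nat.lt_or_ge (x : ℕ) n with h | h
  · have hdu : down (up x) = x := Fin.ext (by simp [up, down, h])
    rw [gen_apply, gen_apply, hdu]
    have hr := hrates x h
    have h0 := sub_nonneg.2 (hc x)
    have h1 := abs_le.1 (hg x)
    have h2 := abs_le.1 (hg (up x))
    have h3 := abs_le.1 (abs_down_sub_le hg x)
    have hl := B.lam_nonneg (up x)
    have hn := B.nu_nonneg x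
    have hr' := mul_le_mul_of_nonneg_right hr hm
    rw [abs_le]
    constructor
    · nlinarith [mul_le_mul_of_nonneg_left h1.1 h0, mul_le_mul_of_nonneg_left h2.1 hl,
        mul_le_mul_of_nonneg_left h3.2 hn]
    · nlinarith [mul_le_mul_of_nonneg_left h1.2 h0, mul_le_mul_of_nonneg_left h2.2 hl,
        mul_le_mul_of_nonneg_left h3.1 hn]
  · have hux : up x = x := by simp [up, not_lt.2 h]
    rw [hux]
    simpa using mul_nonneg (sub_nonneg.2 hcK) hm

lemma abs_gradient_expGen_le
    (hrates : ∀ x : Fin (n + 1), (x : ℕ) < n →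
      K ≤ B.lam x - B.lam (up x) + B.nu (up x) - B.nu x)
    {g : Fin (n + 1) → ℝ} {m : ℝ} (hg : ∀ x, |g (up x) - g x| ≤ m) {t : ℝ} (ht : 0 ≤ t)
    (x : Fin (n + 1)) :
    |B.expGen t g (up x) - B.expGen t g x| ≤ Real.exp (-K * t) * m := by
  have hm : 0 ≤ m := (abs_nonneg _).trans (hg 0)
  obtain ⟨c, hcK, hc⟩ : ∃ c, K ≤ c ∧ ∀ x : Fin (n + 1), B.lam x + B.nu (up x) ≤ c := by
    obtain ⟨b, hb⟩ := (Set.finite_range fun x : Fin (n + 1) => B.lam x + B.nu (up x)).bddAbove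
    exact ⟨max K b, le_max_left _ _, fun x => (hb ⟨x, rfl⟩).trans (le_max_right _ _)⟩
  set u : ℝ → Fin (n + 1) → ℝ := fun s => B.expGen s g with hu
  have hder : ∀ s, HasDerivAt (fun s x => Real.exp (c * s) * (u s (up x) - u s x))
      (fun x => Real.exp (c * s) *
        (c * (u s (up x) - u s x) + (B.gen (u s) (up x) - B.gen (u s) x))) s := by
    intro s
    rw [hasDerivAt_pi]
    intro z
    have h1 := hasDerivAt_pi.1 (B.hasDerivAt_expGen_apply g s)
    have h2 : HasDerivAt (fun s : ℝ => Real.exp (c * s)) (Real.exp (c * s) * c) s := by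
      simpa using ((hasDerivAt_id s).const_mul c).exp
    refine (h2.mul ((h1 (up z)).sub (h1 z))).congr_deriv ?_
    simp only [hu, Pi.sub_apply]
    ring
  have hgron := norm_le_gronwallBound_of_norm_deriv_right_le (δ := m) (K := c - K) (ε := 0)
    (a := 0) (b := t) (fun s _ => (hder s).continuousAt.continuousWithinAt)
    (fun s _ => (hder s).hasDerivWithinAt) ?_ (fun s _ => ?_) t ⟨ht, le_rfl⟩
  · rw [gronwallBound_ε0, sub_zero] at hgron
    have h1 := (norm_le_pi_norm _ x).trans hgron
    rw [Real.norm_eq_abs, abs_mul, abs_of_pos (Real.exp_pos _)] at h1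
    have h2 : Real.exp ((c - K) * t) = Real.exp (c * t) * Real.exp (-K * t) := by
      rw [← Real.exp_add]; ring_nf
    rw [h2] at h1
    refine le_of_mul_le_mul_left (h1.trans_eq ?_) (Real.exp_pos (c * t))
    ring
  · refine (pi_norm_le_iff_of_nonneg hm).2 fun z => ?_
    simpa [hu, B.expGen_zero] using hg z
  · rw [add_zero]
    refine (pi_norm_le_iff_of_nonneg
      (mul_nonneg (sub_nonneg.2 hcK) (norm_nonneg _))).2 fun z => ?_
    rw [Real.norm_eq_abs, abs_mul, abs_of_pos (Real.exp_pos _)]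
    set F : Fin (n + 1) → ℝ := fun x => Real.exp (c * s) * (u s (up x) - u s x) with hF
    have hgrad : ∀ w, |u s (up w) - u s w| ≤ Real.exp (-(c * s)) * ‖F‖ := by
      intro w
      have h1 := norm_le_pi_norm F w
      rw [hF, Real.norm_eq_abs, abs_mul, abs_of_pos (Real.exp_pos _), ← hF] at h1
      rw [Real.exp_neg, inv_mul_eq_div, le_div_iff₀ (Real.exp_pos _)]
      linarith
    refine (mul_le_mul_of_nonneg_left
      (B.abs_mul_gradient_add_gradient_gen_le hrates hcK hc hgrad z)
      (Real.exp_pos (c * s)).le).trans_eq ?_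
    rw [Real.exp_neg]
    field_simp

/-! ### Laplace transforms -/

lemma rate_le_iSup (x : Fin (n + 1)) : B.lam x + B.nu x ≤ ⨆ z, B.lam z + B.nu z :=
  le_ciSup (f := fun z => B.lam z + B.nu z) (Set.finite_range _).bddAbove x

lemma gen_exp_le {g : Fin (n + 1) → ℝ} {m : ℝ} (hg : ∀ x, |g (up x) - g x| ≤ m)
    (x : Fin (n + 1)) :
    B.gen (fun z => Real.exp (g z)) x - Real.exp (g x) * B.gen g x ≤
      (⨆ z, B.lam z + B.nu z) * expRemainder m * Real.exp (g x) := by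
  have hexp : ∀ z, Real.exp (g z) = Real.exp (g x) * Real.exp (g z - g x) := by
    intro z
    rw [← Real.exp_add]; ring_nf
  have h0 : B.gen (fun z => Real.exp (g z)) x - Real.exp (g x) * B.gen g x =
      (B.lam x * expRemainder (g (up x) - g x) + B.nu x * expRemainder (g (down x) - g x)) *
        Real.exp (g x) := by
    rw [gen_apply, gen_apply, hexp (up x), hexp (down x)]
    unfold expRemainder
    ring
  rw [h0]
  refine mul_le_mul_of_nonneg_right ?_ (Real.exp_pos _).le
  have h1 := mul_le_mul_of_nonneg_left (expRemainder_le_of_abs_le (hg x)) (B.lam_nonneg x)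
  have h2 := mul_le_mul_of_nonneg_left (expRemainder_le_of_abs_le (abs_down_sub_le hg x))
    (B.nu_nonneg x)
  have h3 := mul_le_mul_of_nonneg_right (B.rate_le_iSup x) (expRemainder_nonneg m)
  linarith

lemma act_exp_le (hK : 0 < K)
    (hrates : ∀ x : Fin (n + 1), (x : ℕ) < n →
      K ≤ B.lam x - B.lam (up x) + B.nu (up x) - B.nu x)
    {f : Fin (n + 1) → ℝ} {C : ℝ} (hf : ∀ x, |f (up x) - f x| ≤ C)
    {θ : ℝ} (hθ : 0 ≤ θ) {t : ℝ} (ht : 0 ≤ t) (x : Fin (n + 1)) :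
    B.act t (fun z => Real.exp (θ * f z)) x ≤ Real.exp (θ * B.act t f x +
      (⨆ z, B.lam z + B.nu z) * (1 - Real.exp (-2 * K * t)) / (2 * K) *
        expRemainder (θ * C)) := by
  have hC : 0 ≤ C := (abs_nonneg _).trans (hf 0)
  set N := ⨆ z, B.lam z + B.nu z with hN
  have hN0 : 0 ≤ N :=
    (add_nonneg (B.lam_nonneg 0) (B.nu_nonneg 0)).trans (B.rate_le_iSup 0)
  set φ := expRemainder (θ * C) with hφ
  set w : ℝ → Fin (n + 1) → ℝ := fun s z => Real.exp (θ * B.expGen (t - s) f z) with hw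
  set a : ℝ → ℝ := fun s => N * φ / (2 * K) * Real.exp (-2 * K * (t - s)) with ha
  have hlin : ∀ s : ℝ, HasDerivAt (fun s : ℝ => t - s) (-1) s := fun s => by
    simpa using (hasDerivAt_id s).const_sub t
  have hda : ∀ s, HasDerivAt a (N * φ * Real.exp (-2 * K * (t - s))) s := by
    intro s
    refine ((((hlin s).const_mul (-2 * K)).exp).const_mul (N * φ / (2 * K))).congr_deriv ?_
    field_simp
  set w' : ℝ → Fin (n + 1) → ℝ := fun s z =>
    -(Real.exp (θ * B.expGen (t - s) f z) * B.gen (θ • B.expGen (t - s) f) z) with hw'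
  have hdw : ∀ s, HasDerivAt w (w' s) s := by
    intro s
    rw [hasDerivAt_pi]
    intro z
    have h1 := (B.hasDerivAt_expGen_apply f (t - s)).scomp s (hlin s)
    have h2 := ((hasDerivAt_pi.1 h1 z).const_mul θ).exp
    refine h2.congr_deriv ?_
    simp [hw']
  set ψ : ℝ → ℝ := fun s => Real.exp (-a s) * B.expGen s (w s) x with hψ
  have hdψ : ∀ s, HasDerivAt ψ (Real.exp (-a s) * (B.expGen s (B.gen (w s) + w' s) x -
      N * φ * Real.exp (-2 * K * (t - s)) * B.expGen s (w s) x)) s := by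
    intro s
    have h1 := hasDerivAt_pi.1 ((B.hasDerivAt_expGen s).clm_apply (hdw s)) x
    refine ((hda s).neg.exp.mul h1).congr_deriv ?_
    simp only [map_add, Pi.add_apply, Pi.neg_apply, mul_apply_eq_comp]
    ring
  have hanti : AntitoneOn ψ (Icc 0 t) := by
    refine antitoneOn_of_deriv_nonpos (convex_Icc 0 t)
      (fun s _ => (hdψ s).continuousAt.continuousWithinAt)
      (fun s _ => (hdψ s).differentiableAt.differentiableWithinAt) (fun s hs => ?_)
    rw [interior_Icc] at hs
    rw [(hdψ s).deriv]
    refine mul_nonpos_of_nonneg_of_nonpos (Real.exp_pos _).le (sub_nonpos.2 ?_)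
    have hpt : ∀ z, (B.gen (w s) + w' s) z ≤
        ((N * φ * Real.exp (-2 * K * (t - s))) • w s) z := by
      intro z
      have hgrad : ∀ z, |(θ • B.expGen (t - s) f) (up z) - (θ • B.expGen (t - s) f) z| ≤
          Real.exp (-K * (t - s)) * (θ * C) := by
        intro z
        have h1 := B.abs_gradient_expGen_le hrates hf (sub_nonneg.2 hs.2.le) z
        simp only [Pi.smul_apply, smul_eq_mul]
        rw [← mul_sub, abs_mul, abs_of_nonneg hθ]
        have h2 := mul_le_mul_of_nonneg_left h1 hθ
        linarith
      have h1 := B.gen_exp_le hgrad z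
      have hle1 : Real.exp (-K * (t - s)) ≤ 1 := by
        rw [Real.exp_le_one_iff]
        nlinarith [hs.2]
      have h2 := expRemainder_mul_le (Real.exp_pos (-K * (t - s))).le hle1 (mul_nonneg hθ hC)
      have h3 : Real.exp (-K * (t - s)) ^ 2 = Real.exp (-2 * K * (t - s)) := by
        rw [← Real.exp_nat_mul]
        push_cast
        ring_nf
      rw [h3] at h2
      have h4 := mul_le_mul_of_nonneg_right (mul_le_mul_of_nonneg_left h2 hN0)
        (Real.exp_pos ((θ • B.expGen (t - s) f) z)).le
      have h5 := h1.trans h4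
      simp only [Pi.add_apply, Pi.smul_apply, smul_eq_mul, hw, hw'] at h5 ⊢
      linarith
    have h6 := B.act_mono hs.1.le hpt x
    rw [B.act_eq_expGen hs.1.le, B.act_eq_expGen hs.1.le, map_smul] at h6
    exact h6
  have hend := hanti (left_mem_Icc.2 ht) (right_mem_Icc.2 ht) ht
  have hwt : w t = fun z => Real.exp (θ * f z) := by
    simp only [hw, sub_self, B.expGen_zero]
  have h0 : ψ 0 = Real.exp (-a 0) * Real.exp (θ * B.act t f x) := by
    simp only [hψ, hw, B.expGen_zero, sub_zero, B.act_eq_expGen ht]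
  have ht' : ψ t = Real.exp (-a t) * B.act t (fun z => Real.exp (θ * f z)) x := by
    simp only [hψ, hwt, B.act_eq_expGen ht]
  rw [h0, ht', Real.exp_neg, inv_mul_eq_div, div_le_iff₀ (Real.exp_pos _),
    ← Real.exp_add, ← Real.exp_add] at hend
  refine hend.trans_eq (congrArg Real.exp ?_)
  simp only [ha, sub_zero, sub_self, mul_zero, Real.exp_zero]
  ring

/-- Integration of `P_t g` against the stationary distribution. -/
lemma sum_pi_mul_act {t : ℝ} (ht : 0 ≤ t) (g : Fin (n + 1) → ℝ) :
    ∑ z, B.pi z * B.act t g z = ∑ z, B.pi z * g z := by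
  simp only [act, Finset.mul_sum]
  rw [Finset.sum_comm]
  simp only [← mul_assoc, ← Finset.sum_mul, B.pi_stationary t ht]

lemma act_le_sum_pi_add
    (hrates : ∀ x : Fin (n + 1), (x : ℕ) < n →
      K ≤ B.lam x - B.lam (up x) + B.nu (up x) - B.nu x)
    {f : Fin (n + 1) → ℝ} {C : ℝ} (hf : ∀ x, |f (up x) - f x| ≤ C)
    {t : ℝ} (ht : 0 ≤ t) (x : Fin (n + 1)) :
    B.act t f x ≤ (∑ z, B.pi z * f z) + 2 * n * (Real.exp (-K * t) * C) := by
  have hosc := abs_sub_le_of_gradient_le (B.abs_gradient_expGen_le hrates hf ht)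
  rw [← B.act_eq_expGen ht] at hosc
  calc B.act t f x = ∑ z, B.pi z * B.act t f x := by rw [← Finset.sum_mul, B.pi_sum, one_mul]
    _ ≤ ∑ z, B.pi z * (B.act t f z + 2 * n * (Real.exp (-K * t) * C)) := by
        refine Finset.sum_le_sum fun z _ => mul_le_mul_of_nonneg_left ?_ (B.pi_nonneg z)
        linarith [(abs_le.1 (hosc x z)).2]
    _ = _ := by
        simp only [mul_add, Finset.sum_add_distrib, ← Finset.sum_mul, B.pi_sum, one_mul,
          B.sum_pi_mul_act ht]

lemma sum_pi_exp_le (hK : 0 < K)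
    (hrates : ∀ x : Fin (n + 1), (x : ℕ) < n →
      K ≤ B.lam x - B.lam (up x) + B.nu (up x) - B.nu x)
    {f : Fin (n + 1) → ℝ} {C : ℝ} (hf : ∀ x, |f (up x) - f x| ≤ C)
    {θ : ℝ} (hθ : 0 ≤ θ) :
    ∑ z, B.pi z * Real.exp (θ * f z) ≤ Real.exp (θ * (∑ z, B.pi z * f z) +
      (⨆ z, B.lam z + B.nu z) / (2 * K) * expRemainder (θ * C)) := by
  set N := ⨆ z, B.lam z + B.nu z with hN
  have hN0 : 0 ≤ N :=
    (add_nonneg (B.lam_nonneg 0) (B.nu_nonneg 0)).trans (B.rate_le_iSup 0)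
  have hbound : ∀ t, 0 ≤ t → ∑ z, B.pi z * Real.exp (θ * f z) ≤
      Real.exp (θ * ((∑ z, B.pi z * f z) + 2 * n * (Real.exp (-K * t) * C)) +
        N / (2 * K) * expRemainder (θ * C)) := by
    intro t ht
    rw [← B.sum_pi_mul_act ht]
    refine (Finset.sum_le_sum fun z _ => mul_le_mul_of_nonneg_left
      ((B.act_exp_le hK hrates hf hθ ht z).trans (Real.exp_le_exp.2 (add_le_add
        (mul_le_mul_of_nonneg_left (B.act_le_sum_pi_add hrates hf ht z) hθ)
        (mul_le_mul_of_nonneg_right ?_ (expRemainder_nonneg _))))) (B.pi_nonneg z)).trans_eq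
        (by rw [← Finset.sum_mul, B.pi_sum, one_mul])
    refine div_le_div_of_nonneg_right ?_ (by linarith)
    exact mul_le_of_le_one_right hN0 (by linarith [Real.exp_pos (-2 * K * t)])
  have hexp : Filter.Tendsto (fun t : ℝ => Real.exp (-K * t)) Filter.atTop (nhds 0) :=
    Real.tendsto_exp_atBot.comp (Filter.tendsto_id.const_mul_atTop_of_neg (neg_neg_of_pos hK))
  have hlim := (Real.continuous_exp.tendsto _).comp
    (((((hexp.mul_const C).const_mul (2 * (n : ℝ))).const_add (∑ z, B.pi z * f z)).const_mul
      θ).add_const (N / (2 * K) * expRemainder (θ * C)))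
  rw [zero_mul, mul_zero, add_zero] at hlim
  exact ge_of_tendsto hlim (Filter.eventually_atTop.2 ⟨0, hbound⟩)

end BDChainFin

lemma abs_up_sub_le_lipNormFin {n : ℕ} (f : Fin (n + 1) → ℝ) (x : Fin (n + 1)) :
    |f (BDChainFin.up x) - f x| ≤ lipNormFin f := by
  by_cases h : (x : ℕ) < n
  · refine le_csSup (Set.Finite.bddAbove ?_) ⟨BDChainFin.up x, x, ?_, ?_⟩
    · refine (Set.finite_range fun p : Fin (n + 1) × Fin (n + 1) =>
        |f p.1 - f p.2| / |((p.1 : ℕ) : ℝ) - ((p.2 : ℕ) : ℝ)|).subset ?_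
      rintro r ⟨a, b, -, rfl⟩
      exact ⟨(a, b), rfl⟩
    · simp [BDChainFin.up, h, Fin.ext_iff]
    · simp [BDChainFin.up, h]
  · have : BDChainFin.up x = x := by simp [BDChainFin.up, h]
    rw [this, sub_self, abs_zero]
    refine Real.sSup_nonneg ?_
    rintro r ⟨a, b, -, rfl⟩
    positivity

/- STATEMENT 13 (Corollary 4.9): for a birth–death process on `{0,…,n}` whose
rates satisfy `min_{1 ≤ x ≤ n}(λ_{x-1} - λ_x + ν_x - ν_{x-1}) ≥ K` with
`K > 0`, any Lipschitz `f`, any starting point `x`, `t > 0` and `y > 0`, with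
`m = E_x[f(X_t)]`, `mπ = π(f)` and `N = ‖λ + ν‖_∞`:
`ℙ_x(f(X_t) - m ≥ y) ≤ exp(-(y/(2‖f‖_Lip)) log(1 + 2Ky/((1-e^{-2Kt}) N ‖f‖_Lip)))`
and, under the stationary distribution,
`π(f - π(f) ≥ y) ≤ exp(-(y/(2‖f‖_Lip)) log(1 + 2Ky/(N ‖f‖_Lip)))`. -/
theorem birthDeathFin_deviation_positive_wasserstein_curvature
    {n : ℕ} (B : BDChainFin n) (K : ℝ) (hK : 0 < K)
    (hrates : ∀ x : Fin (n + 1), ∀ h : (x : ℕ) < n,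
      K ≤ B.lam x - B.lam ⟨(x : ℕ) + 1, by omega⟩ +
        B.nu ⟨(x : ℕ) + 1, by omega⟩ - B.nu x)
    (f : Fin (n + 1) → ℝ)
    (x : Fin (n + 1)) (t : ℝ) (ht : 0 < t) (y : ℝ) (hy : 0 < y) :
    (∑ z : Fin (n + 1), if y ≤ f z - ∑ w, f w * B.P t x w then B.P t x z else 0) ≤
        Real.exp (-(y / (2 * lipNormFin f)) *
          Real.log (1 + 2 * K * y /
            ((1 - Real.exp (-2 * K * t)) * (⨆ z, B.lam z + B.nu z) * lipNormFin f))) ∧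
      (∑ z : Fin (n + 1), if y ≤ f z - ∑ w, f w * B.pi w then B.pi z else 0) ≤
        Real.exp (-(y / (2 * lipNormFin f)) *
          Real.log (1 + 2 * K * y / ((⨆ z, B.lam z + B.nu z) * lipNormFin f))) := by
  have hr : ∀ x : Fin (n + 1), (x : ℕ) < n → K ≤ B.lam x - B.lam (BDChainFin.up x) +
      B.nu (BDChainFin.up x) - B.nu x := by
    intro x h
    have hx := hrates x h
    simpa only [BDChainFin.up, h, dif_pos] using hx
  have hf := abs_up_sub_le_lipNormFin f
  set C := lipNormFin f with hCdef
  have hC0 : 0 ≤ C := (abs_nonneg _).trans (hf 0)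
  rcases hC0.eq_or_lt with hC | hC
  · have hconst : ∀ z w, f z = f w := by
      intro z w
      have h1 := BDChainFin.abs_sub_le_of_gradient_le hf z w
      rw [← hC, mul_zero] at h1
      exact sub_eq_zero.1 (abs_eq_zero.1 (le_antisymm h1 (abs_nonneg _)))
    have hzero : ∀ p : Fin (n + 1) → ℝ, ∑ w, p w = 1 →
        (∑ z, if y ≤ f z - ∑ w, f w * p w then p z else 0) = 0 := by
      intro p hp
      refine Finset.sum_eq_zero fun z _ => if_neg ?_
      rw [Finset.sum_congr rfl fun w _ => by rw [hconst w z], ← Finset.mul_sum, hp]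
      linarith
    rw [hzero _ (B.P_sum t x ht.le), hzero _ B.pi_sum]
    exact ⟨(Real.exp_pos _).le, (Real.exp_pos _).le⟩
  · set N := ⨆ z, B.lam z + B.nu z with hNdef
    have hN : 0 < N := by
      have hn : 0 < n := by
        rcases Nat.eq_zero_or_pos n with rfl | h
        · have : lipNormFin f = 0 := by
            unfold lipNormFin
            convert Real.sSup_empty
            refine Set.eq_empty_of_forall_notMem ?_
            rintro r ⟨a, b, hab, -⟩
            exact hab (Fin.ext (by omega))
          linarith
        · exact h
      exact (add_pos_of_pos_of_nonneg (B.lam_pos 0 hn) (B.nu_nonneg 0)).trans_le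
        (B.rate_le_iSup 0)
    have hE : 0 < 1 - Real.exp (-2 * K * t) := by
      rw [sub_pos, Real.exp_lt_one_iff]
      nlinarith
    constructor
    · have hM : 0 < N * (1 - Real.exp (-2 * K * t)) / (2 * K) := by positivity
      have h1 := sum_deviation_le_of_laplace_le (B.P t x) f (fun z => B.P_nonneg t x z ht.le)
        hM hC hy (fun θ hθ => B.act_exp_le hK hr hf hθ ht.le x)
      simp only [BDChainFin.act, mul_comm (B.P t x _) (f _)] at h1
      refine h1.trans_eq ?_
      congr 4
      field_simp
    · have hM : 0 < N / (2 * K) := by positivity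
      have h1 := sum_deviation_le_of_laplace_le B.pi f B.pi_nonneg hM hC hy
        (fun θ hθ => B.sum_pi_exp_le hK hr hf hθ)
      simp only [mul_comm (B.pi _) (f _)] at h1
      refine h1.trans_eq ?_
      congr 4
      field_simp
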